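/- Let W be a d×d unitary matrix with real trace. If (Tr W)(W + W*) is proportional to the identity and Tr W ≠ 0, then W has at most two distinct eigenvalues, each occurring with multiplicity d/2; in particular d must be even unless W is a multiple of the identity. -/

import Mathlib

open scoped Matrix
open Polynomial

theorem unitary_MEI_eigenvalue_structure
    {d : ℕ} (W : Matrix (Fin d) (Fin d) ℂ)
    (hW : W ∈ Matrix.unitaryGroup (Fin d) ℂ)
    (htr : (W.trace).im = 0) (htr0 : W.trace ≠ 0)
    (hprop : ∃ c : ℂ, W.trace • (W + Wᴴ) = c • (1 : Matrix (Fin d) (Fin d) ℂ)) :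
    (∃ c : ℂ, W = c • (1 : Matrix (Fin d) (Fin d) ℂ)) ∨
      (Even d ∧ ∃ μ₁ μ₂ : ℂ, μ₁ ≠ μ₂ ∧
        W.charpoly = (X - C μ₁) ^ (d / 2) * (X - C μ₂) ^ (d / 2)) := by
  classical
  obtain ⟨c₀, hc₀⟩ := hprop
  obtain ⟨c, hc⟩ : ∃ c : ℂ, W + Wᴴ = c • (1 : Matrix (Fin d) (Fin d) ℂ) := by
    refine ⟨W.trace⁻¹ * c₀, ?_⟩
    rw [mul_smul, ← hc₀, smul_smul, inv_mul_cancel₀ htr0, one_smul]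
  have hWW : W * Wᴴ = 1 := Matrix.mem_unitaryGroup_iff.mp hW
  have hd : d ≠ 0 := by
    rintro rfl
    exact htr0 (by simp [Matrix.trace])
  have : NeZero d := ⟨hd⟩
  have hWs : Wᴴ = c • (1 : Matrix (Fin d) (Fin d) ℂ) - W := by rw [← hc]; abel
  have hquad : c • W - W * W = 1 := by
    rw [← hWW, hWs, mul_sub, mul_smul_comm, mul_one]
  have htrace : 2 * W.trace = c * d := by
    have h := congrArg Matrix.trace hc
    have hs : star W.trace = W.trace := Complex.conj_eq_iff_im.mpr htr
    rw [Matrix.trace_add, Matrix.trace_conjTranspose, hs, Matrix.trace_smul, Matrix.trace_one] at h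
    simp at h
    linear_combination h
  obtain ⟨s, hs⟩ := IsAlgClosed.exists_pow_nat_eq (c ^ 2 - 4) (n := 2) (by norm_num)
  obtain ⟨m₁, m₂, hsum, hprod⟩ : ∃ m₁ m₂ : ℂ, m₁ + m₂ = c ∧ m₁ * m₂ = 1 :=
    ⟨(c + s) / 2, (c - s) / 2, by ring, by linear_combination (-1 / 4) * hs⟩
  by_cases hne : m₁ = m₂
  · left
    subst hne
    refine ⟨m₁, ?_⟩
    have hm : star m₁ = m₁ := by
      rcases mul_self_eq_one_iff.mp hprod with h | h <;> simp [h]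
    rw [← sub_eq_zero]
    open scoped ComplexOrder in rw [← Matrix.conjTranspose_mul_self_eq_zero]
    have h1 : (W - m₁ • (1 : Matrix (Fin d) (Fin d) ℂ))ᴴ = m₁ • 1 - W := by
      rw [Matrix.conjTranspose_sub, Matrix.conjTranspose_smul, hm, Matrix.conjTranspose_one, hWs,
        ← hsum, add_smul]
      abel
    rw [h1]
    simp only [sub_mul, mul_sub, smul_mul_assoc, mul_smul_comm, one_mul, mul_one]
    rw [smul_sub, smul_smul, hprod, one_smul]
    have h2 : m₁ • W + m₁ • W - W * W = 1 := by rw [← add_smul, hsum, hquad]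
    rw [← sub_eq_zero.mpr h2]
    abel
  · right
    have hroot : ∀ x ∈ W.charpoly.roots, x = m₁ ∨ x = m₂ := by
      intro x hx
      have hx' : x ∈ spectrum ℂ W :=
        Matrix.mem_spectrum_iff_isRoot_charpoly.mpr (isRoot_of_mem_roots hx)
      have h := spectrum.subset_polynomial_aeval W (C c * X - X * X - 1 : ℂ[X]) ⟨x, hx', rfl⟩
      have h0 : aeval W (C c * X - X * X - 1 : ℂ[X]) = 0 := by
        simp [← Algebra.smul_def, hquad]
      rw [h0, spectrum.zero_eq] at h
      simp at h
      have : (x - m₁) * (x - m₂) = 0 := by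
        linear_combination -h + hprod - x * hsum
      rcases mul_eq_zero.mp this with h | h
      · left; linear_combination h
      · right; linear_combination h
    have key : ∀ t : Multiset ℂ, (∀ x ∈ t, x = m₁ ∨ x = m₂) →
        ∃ a b : ℕ, t = Multiset.replicate a m₁ + Multiset.replicate b m₂ := by
      intro t
      induction t using Multiset.induction_on with
      | empty => exact fun _ => ⟨0, 0, by simp⟩
      | cons y t ih =>
        intro h
        obtain ⟨a, b, hab⟩ := ih fun x hx => h x (Multiset.mem_cons_of_mem hx)
        rcases h y (Multiset.mem_cons_self y t) with rfl | rfl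
        · exact ⟨a + 1, b, by rw [hab, Multiset.replicate_succ, Multiset.cons_add]⟩
        · exact ⟨a, b + 1, by rw [hab, Multiset.replicate_succ, Multiset.add_cons]⟩
    obtain ⟨a, b, hab⟩ := key _ hroot
    have hsp : W.charpoly.Splits := IsAlgClosed.splits _
    have hcard : a + b = d := by
      have h := hsp.natDegree_eq_card_roots
      rw [hab, Matrix.charpoly_natDegree_eq_dim] at h
      simpa using h.symm
    have ht := Matrix.trace_eq_sum_roots_charpoly W
    rw [hab] at ht
    simp at ht
    have hdc : (a : ℂ) + b = d := by exact_mod_cast hcard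
    have hz : ((a : ℂ) - b) * (m₁ - m₂) = 0 := by
      linear_combination -2 * ht + htrace - c * hdc - (a + b) * hsum
    have habe : a = b := by
      rcases mul_eq_zero.mp hz with h | h
      · exact_mod_cast sub_eq_zero.mp h
      · exact absurd (sub_eq_zero.mp h) hne
    subst habe
    refine ⟨⟨a, hcard.symm⟩, m₁, m₂, hne, ?_⟩
    have hd2 : d / 2 = a := by omega
    rw [hd2]
    have h := hsp.eq_prod_roots_of_monic (Matrix.charpoly_monic W)
    rw [h, hab]
    simp
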